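/- Let M(z) = Σ_{n≥0} C(3n,n)/(n+1) · zⁿ (convergent for |z| < 4/27) and T(z) = (8z² + 12z + 3 − √(9+8z))/(16(1+z)³). Then there exists ε > 0 such that for all real z with |z| < ε, M(T(z)) = 1 + z. -/

import Mathlib

/-- The moment generating function of `μ₀`, whose moments are `C(3n,n)/(n+1)`. -/
noncomputable def M (z : ℝ) : ℝ :=
  ∑' n : ℕ, (Nat.choose (3 * n) n : ℝ) / (n + 1) * z ^ n

/-- The compositional inverse of `M − 1` near `0`. -/
noncomputable def T (z : ℝ) : ℝ :=
  (8 * z ^ 2 + 12 * z + 3 - Real.sqrt (9 + 8 * z)) / (16 * (1 + z) ^ 3)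

open Polynomial in
noncomputable def auxP (q : ℕ) : ℝ[X] :=
  C 2 * (C 2 * X + C 1) * ∏ i ∈ Finset.range q, (C 2 * X + C (3 + (i : ℝ)))

open Polynomial in
lemma auxP_deg (q : ℕ) : (auxP q).natDegree < q + 2 := by
  unfold auxP
  have h1 : (∏ i ∈ Finset.range q, (C (2:ℝ) * X + C (3 + (i : ℝ)))).natDegree ≤ q := by
    refine (natDegree_prod_le _ _).trans ?_
    refine (Finset.sum_le_card_nsmul _ _ 1 ?_).trans (by simp)
    intro i _
    exact natDegree_linear_le
  have h2 : (C (2:ℝ) * (C 2 * X + C 1)).natDegree ≤ 1 :=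
    (natDegree_C_mul_le _ _).trans natDegree_linear_le
  have := natDegree_mul_le_of_le h2 h1
  omega

lemma auxP_fact (q n : ℕ) :
    (auxP q).eval (n : ℝ) * (n + 1) * ((2 * n).factorial : ℝ) = ((2 * n + q + 2).factorial : ℝ) := by
  induction q with
  | zero =>
    simp [auxP, Nat.factorial_succ]
    ring
  | succ q ih =>
    have e : 2 * n + (q + 1) + 2 = (2 * n + q + 2) + 1 := by ring
    have : (auxP (q+1)).eval (n:ℝ) = (auxP q).eval (n:ℝ) * (2 * n + (3 + q)) := by
      simp [auxP, Finset.prod_range_succ, mul_assoc]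
    rw [e, Nat.factorial_succ, this]
    push_cast
    rw [← ih]; ring

lemma aux_term (q n k : ℕ) (h : n + k = q + 2) :
    (Nat.choose (3 * n) n : ℝ) / (n + 1) * (Nat.choose (k + 3 * n) (3 * n) : ℝ)
      = (Nat.choose (q + 2) n : ℝ) * (auxP q).eval (n : ℝ) / ((q + 2).factorial : ℝ) := by
  have h1 : (Nat.choose (3 * n) n : ℝ) = ((3*n).factorial : ℝ) / (n.factorial * (2 * n).factorial) := by
    have := Nat.cast_add_choose ℝ (a := n) (b := 2 * n)
    rwa [show n + 2 * n = 3 * n by ring] at this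
  have h2 : (Nat.choose (k + 3 * n) (3 * n) : ℝ)
      = ((2 * n + q + 2).factorial : ℝ) / ((3 * n).factorial * k.factorial) := by
    have := Nat.cast_add_choose ℝ (a := 3 * n) (b := k)
    rw [add_comm k]
    rwa [show 2 * n + q + 2 = 3 * n + k by omega]
  have h3 : (Nat.choose (q + 2) n : ℝ) = ((q+2).factorial : ℝ) / (n.factorial * k.factorial) := by
    rw [← h]; exact Nat.cast_add_choose ℝ
  rw [h1, h2, h3, ← auxP_fact]
  have a1 := Nat.factorial_ne_zero n
  have a2 := Nat.factorial_ne_zero (2*n)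
  have a3 := Nat.factorial_ne_zero (3*n)
  have a4 := Nat.factorial_ne_zero k
  have a5 := Nat.factorial_ne_zero (q+2)
  have a6 : (n:ℝ) + 1 ≠ 0 := by positivity
  field_simp

noncomputable def auxF (w : ℝ) (p : ℕ × ℕ) : ℝ :=
  (Nat.choose (3 * p.1) p.1 : ℝ) / (p.1 + 1) * w ^ p.1 *
    ((Nat.choose (p.2 + 3 * p.1) (3 * p.1) : ℝ) * (-w) ^ p.2)

lemma auxF_anti (w : ℝ) (q : ℕ) :
    ∑ p ∈ Finset.HasAntidiagonal.antidiagonal (q + 2), auxF w p = 0 := by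
  have h0 := congrFun (Polynomial.fwdDiff_iter_eq_zero_of_degree_lt (auxP_deg q)) 0
  rw [fwdDiff_iter_eq_sum_shift] at h0
  simp only [zero_add, nsmul_eq_mul, mul_one, zsmul_eq_mul, Pi.zero_apply] at h0
  push_cast at h0
  rw [← Finset.Nat.sum_antidiagonal_eq_sum_range_succ
    (fun n k => (-1:ℝ) ^ k * (Nat.choose (q+2) n : ℝ) * (auxP q).eval (n:ℝ))] at h0
  have : ∑ p ∈ Finset.HasAntidiagonal.antidiagonal (q + 2), auxF w p =
     (w ^ (q+2) / ((q+2).factorial : ℝ)) * ∑ p ∈ Finset.HasAntidiagonal.antidiagonal (q + 2),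
      (-1:ℝ) ^ p.2 * (Nat.choose (q+2) p.1 : ℝ) * (auxP q).eval (p.1:ℝ) := by
    rw [Finset.mul_sum]
    refine Finset.sum_congr rfl ?_
    rintro ⟨n, k⟩ hp
    have hp' : n + k = q + 2 := by simpa using hp
    have := aux_term q n k hp'
    unfold auxF
    simp only
    calc _ = ((Nat.choose (3 * n) n : ℝ) / (n + 1) * (Nat.choose (k + 3 * n) (3 * n) : ℝ))
            * (w ^ n * (-w) ^ k) := by ring
      _ = _ := by
        rw [this, neg_pow, ← hp', pow_add]; ring
  rw [this, h0, mul_zero]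

lemma auxF_inner (w : ℝ) (hw : |w| < 1) (n : ℕ) :
    HasSum (fun k => auxF w (n, k))
      ((Nat.choose (3 * n) n : ℝ) / (n + 1) * w ^ n * (1 / (1 + w) ^ (3 * n + 1))) := by
  have h := hasSum_choose_mul_geometric_of_norm_lt_one (𝕜 := ℝ) (3 * n) (r := -w) (by simpa using hw)
  rw [sub_neg_eq_add] at h
  exact h.mul_left _

lemma auxF_summable (w : ℝ) (hw : |w| ≤ 1 / 100) : Summable (auxF w) := by
  rw [← summable_norm_iff]
  have key : ∀ n, HasSum (fun k => ‖auxF w (n, k)‖)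
      ((Nat.choose (3 * n) n : ℝ) / (n + 1) * |w| ^ n * (1 / (1 - |w|) ^ (3 * n + 1))) := by
    intro n
    have h := hasSum_choose_mul_geometric_of_norm_lt_one (𝕜 := ℝ) (3 * n) (r := |w|)
      (by rw [Real.norm_eq_abs, abs_abs]; linarith)
    have h2 := h.mul_left ((Nat.choose (3 * n) n : ℝ) / (n + 1) * |w| ^ n)
    have hfe : (fun k => ‖auxF w (n, k)‖) = fun i => (Nat.choose (3 * n) n : ℝ) / (n + 1) * |w| ^ n * ((Nat.choose (i + 3 * n) (3 * n) : ℝ) * |w| ^ i) := by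
     funext k
     have : |(n:ℝ) + 1| = n + 1 := abs_of_nonneg (by positivity)
     simp [auxF, abs_mul, abs_div, this]
    rw [hfe]; exact h2
  rw [summable_prod_of_nonneg (fun _ => norm_nonneg _)]
  refine ⟨fun n => (key n).summable, ?_⟩
  have hk := fun n => (key n).tsum_eq
  simp only [hk]
  have hg : Summable (fun n : ℕ => 2 * (2/3 : ℝ) ^ n) :=
    (summable_geometric_of_lt_one (by norm_num) (by norm_num)).mul_left _
  have hpos : (0:ℝ) < 1 - |w| := by linarith
  refine Summable.of_nonneg_of_le (fun n => by positivity) (fun n => ?_) hg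
  have hc : (Nat.choose (3 * n) n : ℝ) / (n + 1) ≤ 8 ^ n := by
    have h1 : (Nat.choose (3 * n) n : ℝ) ≤ 8 ^ n := by
      have := Nat.choose_le_two_pow (3 * n) n
      rw [pow_mul] at this
      exact_mod_cast this
    refine (div_le_self (by positivity) ?_).trans h1
    have : (0:ℝ) ≤ n := by positivity
    linarith
  have hb : 1 / (1 - |w|) ≤ 2 := by
    rw [div_le_iff₀ hpos]; linarith
  have hb0 : 0 ≤ 1 / (1 - |w|) := by positivity
  calc _ ≤ (8:ℝ) ^ n * (1/100) ^ n * (2 ^ (3 * n + 1)) := by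
        rw [← one_div_pow]
        gcongr
    _ = 2 * (8 * (1/100) * 2 ^ 3) ^ n := by
        rw [mul_pow, mul_pow, ← pow_mul, pow_succ]; ring
    _ ≤ _ := by
        gcongr
        norm_num

lemma aux_main (w : ℝ) (hw : |w| ≤ 1 / 100) :
    M (w / (1 + w) ^ 3) = (1 + w) * (1 + w / 2) := by
  have hs := auxF_summable w hw
  have hpos : (0:ℝ) < 1 + w := by linarith [neg_abs_le w]
  have e1 : ∑' p, auxF w p = M (w / (1 + w) ^ 3) / (1 + w) := by
    rw [hs.tsum_prod, M, ← tsum_div_const]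
    refine tsum_congr fun n => ?_
    rw [(auxF_inner w (by linarith) n).tsum_eq, div_pow, ← pow_mul, pow_succ]
    field_simp
  have e2 : ∑' p, auxF w p = 1 + w / 2 := by
    have hs' := (Finset.HasAntidiagonal.sigmaAntidiagonalEquivProd (A := ℕ)).summable_iff.mpr hs
    rw [← (Finset.HasAntidiagonal.sigmaAntidiagonalEquivProd (A := ℕ)).tsum_eq]
    have := hs'.tsum_sigma' (fun n ↦ (hasSum_fintype _).summable)
    refine this.trans ?_
    have h3 : ∀ n : ℕ, ∑' c : Finset.HasAntidiagonal.antidiagonal n,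
        (auxF w ∘ (Finset.HasAntidiagonal.sigmaAntidiagonalEquivProd (A := ℕ))) ⟨n, c⟩
        = ∑ p ∈ Finset.HasAntidiagonal.antidiagonal n, auxF w p := by
      intro n
      rw [tsum_fintype, ← Finset.sum_coe_sort (Finset.HasAntidiagonal.antidiagonal n)]
      rfl
    simp_rw [h3]
    rw [tsum_eq_sum (s := Finset.range 2)]
    · simp [Finset.sum_range_succ, auxF, Finset.Nat.antidiagonal_succ]
      ring
    · intro n hn
      obtain ⟨q, rfl⟩ : ∃ q, n = q + 2 := ⟨n - 2, by simp at hn; omega⟩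
      exact auxF_anti w q
  rw [e1, div_eq_iff hpos.ne'] at e2
  rw [e2]; ring

theorem stmt_14 :
    ∃ ε > (0 : ℝ), ∀ z : ℝ, |z| < ε → M (T z) = 1 + z := by
  refine ⟨1/100, by norm_num, fun z hz => ?_⟩
  obtain ⟨hz1, hz2⟩ := abs_lt.mp hz
  set s := Real.sqrt (9 + 8 * z) with hs
  have hs0 : 0 ≤ s := Real.sqrt_nonneg _
  have hss : s ^ 2 = 9 + 8 * z := Real.sq_sqrt (by linarith)
  have hz' : z = (s ^ 2 - 9) / 8 := by linarith
  have hw : |(s - 3) / 2| ≤ 1 / 100 := by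
    rw [abs_le]; constructor <;> nlinarith
  have hm := aux_main _ hw
  have hT : T z = ((s - 3) / 2) / (1 + (s - 3) / 2) ^ 3 := by
    unfold T
    rw [← hs]
    have h1 : 1 + z ≠ 0 := by linarith
    have h2 : 1 + (s - 3) / 2 ≠ 0 := by
      have := (abs_le.mp hw).1
      linarith
    rw [div_eq_div_iff (by positivity) (by positivity)]
    rw [hz']
    ring
  rw [hT, hm, hz']
  ring
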